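/- Assume A satisfies condition (103) and condition (108) for some m > 1. Then the inequality σ_k(λ(D_i(A(|Du|)D_j u)))^{1/k} ≥ e^u in ℝ^n has no solution u ∈ C²(ℝ^n∖{0}) ∩ Φ^k(ℝ^n). -/

import Mathlib

open Filter MeasureTheory Set Topology
open scoped ENNReal

noncomputable section

abbrev Euc (n : ℕ) := EuclideanSpace ℝ (Fin n)

/-- k-th elementary symmetric function of λ ∈ ℝⁿ. -/
def sigmaElem (n k : ℕ) (lam : Fin n → ℝ) : ℝ :=
  ∑ S ∈ Finset.powersetCard k (Finset.univ : Finset (Fin n)), ∏ i ∈ S, lam i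

/-- The cone Γ_k. -/
def GammaK (n k : ℕ) : Set (Fin n → ℝ) :=
  {lam | ∀ l, 1 ≤ l → l ≤ k → 0 < sigmaElem n l lam}

/-- Matrix (D_i V_j) of a vector field V. -/
def jacMatrix {n : ℕ} (V : Euc n → Euc n) (x : Euc n) : Matrix (Fin n) (Fin n) ℝ :=
  fun i j => fderiv ℝ (fun y => V y j) x (EuclideanSpace.single i 1)

/-- Condition (103). -/
def Cond103 (A : ℝ → ℝ) : Prop :=
  ContDiffOn ℝ 1 A (Ioi 0) ∧ (∀ p ∈ Ioi (0:ℝ), 0 < A p) ∧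
  ContinuousOn (fun p => p * A p) (Ici 0) ∧
  StrictMonoOn (fun p => p * A p) (Ioi 0)

/-- Condition (109). -/
def Cond109 (f : ℝ → ℝ) : Prop :=
  ContinuousOn f (Ioi 0) ∧ (∀ t ∈ Ioi (0:ℝ), 0 < f t) ∧ MonotoneOn f (Ioi 0)

/-- Condition (117). -/
def Cond117 (f : ℝ → ℝ) : Prop :=
  Continuous f ∧ (∀ t, 0 < f t) ∧ Monotone f

/-- Condition (108): 0 < liminf A(p)/p^{m-2} ≤ limsup A(p)/p^{m-2} < ∞. -/
def Cond108 (A : ℝ → ℝ) (m : ℝ) : Prop :=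
  ∃ c₁ c₂ : ℝ, 0 < c₁ ∧
    ∀ᶠ p in atTop, c₁ ≤ A p / p ^ (m - 2) ∧ A p / p ^ (m - 2) ≤ c₂

/-- u ∈ C²(ℝⁿ \ {0}) ∩ Φᵏ(ℝⁿ) is an entire solution of inequality (101). -/
def IsEntireSol (n k : ℕ) (A f : ℝ → ℝ) (u : Euc n → ℝ) : Prop :=
  ContDiff ℝ 1 u ∧ ContDiffOn ℝ 2 u {(0 : Euc n)}ᶜ ∧
  ∃ V : Euc n → Euc n, ContDiff ℝ 1 V ∧
    (∀ x, V x = A ‖gradient u x‖ • gradient u x) ∧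
    ∃ hsym : ∀ x, (jacMatrix V x).IsHermitian,
      (∀ x, (hsym x).eigenvalues ∈ GammaK n k) ∧
      ∀ x, f (u x) ≤ (sigmaElem n k ((hsym x).eigenvalues)) ^ ((1:ℝ)/k)

/-- Ψ(p) = p (pA(p))^k − ∫₀^p (tA(t))^k dt. -/
def Psi (A : ℝ → ℝ) (k : ℕ) (p : ℝ) : ℝ :=
  p * (p * A p) ^ k - ∫ t in (0:ℝ)..p, (t * A t) ^ k

/-- Ψ⁻¹, the inverse of Ψ on [0,∞). -/
def PsiInv (A : ℝ → ℝ) (k : ℕ) : ℝ → ℝ :=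
  Function.invFunOn (Psi A k) (Ici 0)

/-- Generalized Keller–Osserman condition (110) with lower limit c. -/
def KO (A f : ℝ → ℝ) (k : ℕ) (c : ℝ) : Prop :=
  ∫⁻ s in Ioi c, ENNReal.ofReal (PsiInv A k (∫ t in c..s, f t ^ k))⁻¹ = ⊤

/-- [0,R) with R ∈ [0,∞]. -/
def IcoE (R : ℝ≥0∞) : Set ℝ := {r : ℝ | 0 ≤ r ∧ ENNReal.ofReal r < R}

/-- (0,R) with R ∈ [0,∞]. -/
def IooE (R : ℝ≥0∞) : Set ℝ := {r : ℝ | 0 < r ∧ ENNReal.ofReal r < R}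

/-- φ is a positive solution of the Cauchy problem (204) on [0,R). -/
def IsCauchySol (n k : ℕ) (A f : ℝ → ℝ) (a : ℝ) (R : ℝ≥0∞) (φ : ℝ → ℝ) : Prop :=
  ContinuousOn φ (IcoE R) ∧
  (∀ r ∈ IooE R, DifferentiableAt ℝ φ r) ∧
  ContinuousOn (deriv φ) (IooE R) ∧
  φ 0 = a ∧
  (∀ r ∈ IcoE R, 0 < φ r) ∧
  ∀ r ∈ IooE R,
    A |deriv φ r| * deriv φ r =
      (n * r ^ ((k:ℝ) - n) / (n.choose k) * ∫ s in (0:ℝ)..r, s ^ (n-1) * f (φ s) ^ k) ^ ((1:ℝ)/k)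


theorem sum_sq_eq_sigmaElem (n : ℕ) (lam : Fin n → ℝ) :
    ∑ i, lam i ^ 2 = sigmaElem n 1 lam ^ 2 - 2 * sigmaElem n 2 lam := by
  have h := congrArg (MvPolynomial.aeval lam) (MvPolynomial.mul_esymm_eq_sum (Fin n) ℝ 2)
  have he : ∀ j, MvPolynomial.aeval lam (MvPolynomial.esymm (Fin n) ℝ j) = sigmaElem n j lam := by
    intro j
    simp [MvPolynomial.esymm, sigmaElem]
  have hp : ∀ j, MvPolynomial.aeval lam (MvPolynomial.psum (Fin n) ℝ j) = ∑ i, lam i ^ j := by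
    intro j
    simp [MvPolynomial.psum]
  have h1 : sigmaElem n 1 lam = ∑ i, lam i := by
    rw [← he]; simp
  have hs : (Finset.HasAntidiagonal.antidiagonal 2).filter (fun a : ℕ × ℕ => a.1 < 2) = {(0, 2), (1, 1)} := by
    decide
  rw [hs] at h
  rw [Finset.sum_pair (by decide)] at h
  simp only [map_mul, map_add, map_pow, map_neg, map_one, map_natCast, he, hp, pow_one] at h
  have h0 : sigmaElem n 0 lam = 1 := by simp [sigmaElem]
  rw [h0, ← h1] at h
  push_cast at h
  linarith

theorem sigmaElem_one (n : ℕ) (lam : Fin n → ℝ) : sigmaElem n 1 lam = ∑ i, lam i := by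
  simp [sigmaElem, Finset.powersetCard_one]

theorem sigmaElem_le_of_mem_GammaK {n k : ℕ} (hk : 1 ≤ k) {lam : Fin n → ℝ}
    (h : lam ∈ GammaK n k) :
    sigmaElem n k lam ≤ n.choose k * (∑ i, lam i) ^ k := by
  have h1 := sigmaElem_one n lam
  obtain rfl | hk2 := hk.eq_or_lt
  · have hpos := h 1 le_rfl le_rfl
    have hn : 1 ≤ n := by
      by_contra hn
      obtain rfl : n = 0 := by omega
      simp [h1] at hpos
    have hn' : (1 : ℝ) ≤ n := by exact_mod_cast hn
    rw [h1] at hpos ⊢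
    simp only [Nat.choose_one_right, pow_one]
    nlinarith
  · have hpos := h 1 le_rfl hk
    have hpos2 := h 2 (by norm_num) hk2
    have hsq := sum_sq_eq_sigmaElem n lam
    rw [h1] at hpos hsq
    have hle : ∀ i, |lam i| ≤ ∑ i, lam i := by
      intro i
      have := Finset.single_le_sum (f := fun i => lam i ^ 2) (fun i _ => sq_nonneg _)
        (Finset.mem_univ i)
      exact abs_le_of_sq_le_sq (by linarith) hpos.le
    calc sigmaElem n k lam
        ≤ ∑ S ∈ Finset.powersetCard k (Finset.univ : Finset (Fin n)), (∑ i, lam i) ^ k := by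
          refine Finset.sum_le_sum fun S hS => ?_
          rw [← (Finset.mem_powersetCard.1 hS).2, ← Finset.prod_const]
          refine (le_abs_self _).trans ?_
          rw [Finset.abs_prod]
          exact Finset.prod_le_prod (fun i _ => abs_nonneg _) (fun i _ => hle i)
      _ = n.choose k * (∑ i, lam i) ^ k := by simp

theorem sigmaElem_rpow_le_of_mem_GammaK {n k : ℕ} (hk : 1 ≤ k) {lam : Fin n → ℝ}
    (h : lam ∈ GammaK n k) :
    sigmaElem n k lam ^ ((1 : ℝ) / k) ≤ (n.choose k : ℝ) ^ ((1 : ℝ) / k) * ∑ i, lam i := by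
  have hpos : 0 < ∑ i, lam i := sigmaElem_one n lam ▸ h 1 le_rfl hk
  calc sigmaElem n k lam ^ ((1 : ℝ) / k)
      ≤ (n.choose k * (∑ i, lam i) ^ k) ^ ((1 : ℝ) / k) :=
        Real.rpow_le_rpow (h k hk le_rfl).le (sigmaElem_le_of_mem_GammaK hk h) (by positivity)
    _ = _ := by
      rw [Real.mul_rpow (by positivity) (by positivity), one_div,
        Real.pow_rpow_inv_natCast hpos.le (by omega)]

theorem exists_growth_bound {A : ℝ → ℝ} {m : ℝ} (hA : Cond103 A) (h : Cond108 A m) :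
    ∃ C : ℝ, 0 ≤ C ∧ ∃ N : ℕ, ∀ p, 0 ≤ p → p * A p ≤ C * (1 + p ^ N) := by
  obtain ⟨c₁, c₂, hc₁, hev⟩ := h
  obtain ⟨P, hP⟩ := eventually_atTop.1 (hev.and (eventually_ge_atTop 1))
  obtain ⟨N, hN⟩ := exists_nat_ge (m - 1)
  obtain ⟨B, hB⟩ := (isCompact_Icc (a := (0 : ℝ)) (b := P)).bddAbove_image
    (hA.2.2.1.mono Icc_subset_Ici_self)
  refine ⟨max 0 (max B c₂), le_max_left _ _, N, fun p hp => ?_⟩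
  have hpN : 0 ≤ p ^ N := by positivity
  rcases le_total p P with hpP | hpP
  · have h1 : p * A p ≤ B := hB (mem_image_of_mem _ ⟨hp, hpP⟩)
    have h2 : B ≤ max 0 (max B c₂) := (le_max_left _ _).trans (le_max_right _ _)
    nlinarith [le_max_left 0 (max B c₂)]
  · obtain ⟨⟨-, h1⟩, hp1⟩ := hP p hpP
    have hp0 : 0 < p := by linarith
    rw [div_le_iff₀ (by positivity)] at h1
    have h2 : c₂ ≤ max 0 (max B c₂) := (le_max_right _ _).trans (le_max_right _ _)
    have h3 : p * p ^ (m - 2) ≤ p ^ N := by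
      rw [← Real.rpow_natCast, mul_comm, ← Real.rpow_add_one hp0.ne']
      exact Real.rpow_le_rpow_of_exponent_le hp1 (by linarith)
    have h4 : 0 ≤ p * p ^ (m - 2) := by positivity
    calc p * A p ≤ c₂ * (p * p ^ (m - 2)) := by nlinarith
      _ ≤ max 0 (max B c₂) * (p * p ^ (m - 2)) := by gcongr
      _ ≤ max 0 (max B c₂) * (1 + p ^ N) := by gcongr; linarith

/-- The term produced by differentiating the cut-off is absorbed by the nonnegative gradient term,
up to an error of order `1 / R`. -/
theorem absorb_gradient {C K R ψ p a q : ℝ} {N : ℕ} (hC : 0 ≤ C) (hK : 0 ≤ K) (hR : 1 ≤ R)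
    (hψ : 0 ≤ ψ) (hψ1 : ψ ≤ 1) (hp : 0 ≤ p) (ha : 0 ≤ a) (haC : a ≤ C * (1 + p ^ N))
    (hq : 1 ≤ q) :
    ψ ^ N * a * (K / R) ≤ q * ψ ^ (N + 1) * a * p + K * (C * (1 + K ^ N)) / R := by
  have hR0 : 0 < R := by linarith
  rcases le_total (K / R) (q * ψ * p) with h | h
  · have : ψ ^ N * a * (K / R) ≤ ψ ^ N * a * (q * ψ * p) := by gcongr
    have h2 : 0 ≤ K * (C * (1 + K ^ N)) / R := by positivity
    rw [pow_succ]
    linarith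
  · have hKR : K / R ≤ K := div_le_self hK hR
    have h1 : ψ * p ≤ K := by nlinarith [mul_nonneg hψ hp]
    have h2 : ψ ^ N * a ≤ C * (1 + K ^ N) :=
      calc ψ ^ N * a ≤ ψ ^ N * (C * (1 + p ^ N)) := by gcongr
        _ = C * (ψ ^ N + (ψ * p) ^ N) := by rw [mul_pow]; ring
        _ ≤ C * (1 + K ^ N) := by
          gcongr
          exact pow_le_one₀ hψ hψ1
    have h3 : ψ ^ N * a * (K / R) ≤ C * (1 + K ^ N) * (K / R) := by gcongr
    have h4 : 0 ≤ q * ψ ^ (N + 1) * a * p := by positivity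
    calc _ ≤ _ := h3
      _ = K * (C * (1 + K ^ N)) / R := by ring
      _ ≤ _ := by linarith

/-- A lower power of `Z` is absorbed by `Z ^ (n + 1)`, up to an error of order `1 / R ^ (n + 1)`. -/
theorem absorb_power {D R c Z : ℝ} (n : ℕ) (hD : 0 ≤ D) (hR : 0 < R) (hc : 0 < c) (hZ : 0 ≤ Z) :
    D / R * Z ^ n ≤ c * Z ^ (n + 1) + D * (D / c) ^ n / R ^ (n + 1) := by
  rcases le_total (D / R) (c * Z) with h | h
  · have : D / R * Z ^ n ≤ c * Z * Z ^ n := by gcongr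
    have h2 : 0 ≤ D * (D / c) ^ n / R ^ (n + 1) := by positivity
    rw [pow_succ]
    linarith
  · have h1 : Z ≤ D / c / R := by
      rw [div_right_comm, le_div_iff₀ hc]
      linarith
    have h2 : 0 ≤ c * Z ^ (n + 1) := by positivity
    calc D / R * Z ^ n ≤ D / R * (D / c / R) ^ n := by gcongr
      _ = D * (D / c) ^ n / R ^ (n + 1) := by
        rw [div_pow (D / c) R, pow_succ]; field_simp
      _ ≤ _ := by linarith

/-- Integration by parts for the divergence `(jacMatrix V x).trace`. -/
theorem integral_mul_trace_jacMatrix {n : ℕ} {φ : Euc n → ℝ} {V : Euc n → Euc n}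
    (hφ : ContDiff ℝ 1 φ) (hc : HasCompactSupport φ) (hV : ContDiff ℝ 1 V) :
    ∫ x, φ x * (jacMatrix V x).trace = -∫ x, fderiv ℝ φ x (V x) := by
  have hVi : ∀ i, ContDiff ℝ 1 fun y => V y i := fun i => by fun_prop
  have hdφ : ∀ v, Continuous fun x => fderiv ℝ φ x v := fun v =>
    (hφ.continuous_fderiv one_ne_zero).clm_apply continuous_const
  have hdV : ∀ i v, Continuous fun x => fderiv ℝ (fun y => V y i) x v := fun i v =>
    ((hVi i).continuous_fderiv one_ne_zero).clm_apply continuous_const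
  have hleft : ∀ i : Fin n, Integrable fun x => φ x *
      fderiv ℝ (fun y => V y i) x (EuclideanSpace.single i 1) := fun i =>
    (hφ.continuous.mul (hdV i _)).integrable_of_hasCompactSupport hc.mul_right
  have hright : ∀ i : Fin n, Integrable fun x =>
      fderiv ℝ φ x (EuclideanSpace.single i 1) * V x i := fun i =>
    ((hdφ _).mul (hVi i).continuous).integrable_of_hasCompactSupport
      (hc.fderiv_apply ℝ _).mul_right
  have hsum : ∀ x, fderiv ℝ φ x (V x) =
      ∑ i, fderiv ℝ φ x (EuclideanSpace.single i 1) * V x i := by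
    intro x
    conv_lhs => rw [← (EuclideanSpace.basisFun (Fin n) ℝ).sum_repr (V x)]
    simp [mul_comm]
  simp_rw [hsum, Matrix.trace, Matrix.diag, jacMatrix, Finset.mul_sum]
  rw [integral_finsetSum _ fun i _ => hleft i, integral_finsetSum _ fun i _ => hright i,
    ← Finset.sum_neg_distrib]
  refine Finset.sum_congr rfl fun i _ => ?_
  exact integral_mul_fderiv_eq_neg_fderiv_mul_of_integrable (hright i) (hleft i)
    ((hφ.continuous.mul (hVi i).continuous).integrable_of_hasCompactSupport hc.mul_right)
    (fun x _ => hφ.differentiable one_ne_zero x)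
    (fun x _ => (hVi i).differentiable one_ne_zero x)

/-- Cut-off functions equal to one on `closedBall 0 R`, supported in `closedBall 0 (2 * R)`, with
gradient of order `1 / R`. -/
theorem exists_cutoff (n : ℕ) : ∃ M : ℝ, 0 ≤ M ∧ ∀ R : ℝ, 0 < R → ∃ ψ : Euc n → ℝ,
    ContDiff ℝ 1 ψ ∧ (∀ x, 0 ≤ ψ x) ∧ (∀ x, ψ x ≤ 1) ∧
    (∀ x ∈ Metric.closedBall 0 R, ψ x = 1) ∧ (∀ x ∉ Metric.closedBall 0 (2 * R), ψ x = 0) ∧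
    ∀ x, ‖fderiv ℝ ψ x‖ ≤ M / R := by
  let b : ContDiffBump (0 : Euc n) := ⟨1, 2, one_pos, one_lt_two⟩
  have hb : ContDiff ℝ 1 b := b.contDiff
  obtain ⟨M, hM⟩ := (hb.continuous_fderiv one_ne_zero).bounded_above_of_compact_support
    (b.hasCompactSupport.fderiv ℝ)
  refine ⟨M, (norm_nonneg _).trans (hM 0), fun R hR => ⟨fun x => b (R⁻¹ • x),
    hb.comp (contDiff_const_smul _), fun x => b.nonneg, fun x => b.le_one, ?_, ?_, ?_⟩⟩
  · intro x hx
    refine b.one_of_mem_closedBall ?_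
    rw [mem_closedBall_zero_iff] at hx ⊢
    rw [norm_smul, norm_inv, Real.norm_of_nonneg hR.le, inv_mul_le_iff₀ hR]
    simpa [b] using hx
  · intro x hx
    refine b.zero_of_le_dist ?_
    rw [mem_closedBall_zero_iff, not_le] at hx
    rw [dist_zero_right, norm_smul, norm_inv, Real.norm_of_nonneg hR.le, le_inv_mul_iff₀ hR]
    simpa [b, mul_comm] using hx.le
  · intro x
    rw [fderiv_comp_smul, norm_smul, norm_inv, Real.norm_of_nonneg hR.le, div_eq_inv_mul]
    gcongr
    exact hM _

/-- Testing `div V ≥ c * exp u` with `ψ ^ s * exp (n * u)` for a cut-off `ψ` at scale `R`. -/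
theorem exists_integral_exp_le {n : ℕ} (hn : 1 ≤ n) {A : ℝ → ℝ} {C c : ℝ} {N : ℕ}
    {u : Euc n → ℝ} {V : Euc n → Euc n} (hA : ∀ p, 0 < p → 0 < A p) (hC : 0 ≤ C)
    (hgrowth : ∀ p, 0 ≤ p → p * A p ≤ C * (1 + p ^ N)) (hc : 0 < c)
    (hu : ContDiff ℝ 1 u) (hV : ContDiff ℝ 1 V)
    (hVu : ∀ x, V x = A ‖gradient u x‖ • gradient u x)
    (hdiv : ∀ x, c * Real.exp (u x) ≤ (jacMatrix V x).trace) :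
    ∃ D : ℝ, ∀ R : ℝ, 1 ≤ R →
      ∫ x in Metric.closedBall (0 : Euc n) 1, Real.exp (u x) ^ (n + 1) ≤ D / R := by
  obtain ⟨M, hM0, hM⟩ := exists_cutoff n
  set s := (N + 1) * (n + 1) with hs
  set K : ℝ := s * M with hK
  have hK0 : 0 ≤ K := by positivity
  set D₁ : ℝ := K * (C * (1 + K ^ N))
  have hD₁0 : 0 ≤ D₁ := by positivity
  set D₂ : ℝ := D₁ * (D₁ / (c / 2)) ^ n
  set ω : ℝ := volume.real (Metric.closedBall (0 : Euc n) 1)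
  refine ⟨D₂ * (2 ^ n * ω) / (c / 2), fun R hR => ?_⟩
  have hR0 : 0 < R := by linarith
  obtain ⟨ψ, hψ, hψ0, hψ1, hψR, hψ2R, hψM⟩ := hM R hR0
  let E : Euc n → ℝ := fun x => Real.exp (u x)
  have hE : ContDiff ℝ 1 E := hu.exp
  have hE0 : ∀ x, 0 < E x := fun x => Real.exp_pos _
  let φ : Euc n → ℝ := fun x => ψ x ^ s * E x ^ n
  have hφ : ContDiff ℝ 1 φ := (hψ.pow s).mul (hE.pow n)
  have hs0 : s ≠ 0 := by positivity
  have hφ2R : ∀ x ∉ Metric.closedBall 0 (2 * R), φ x = 0 := fun x hx => by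
    simp [φ, hψ2R x hx, hs0]
  have hφc : HasCompactSupport φ :=
    HasCompactSupport.intro (isCompact_closedBall 0 (2 * R)) hφ2R
  have hφ0 : ∀ x, 0 ≤ φ x := fun x => mul_nonneg (pow_nonneg (hψ0 x) _) (pow_nonneg (hE0 x).le _)
  have hpt : ∀ x, -fderiv ℝ φ x (V x) ≤ c / 2 * (φ x * E x) + D₂ / R ^ (n + 1) := by
    intro x
    set p := ‖gradient u x‖ with hp
    have hp0 : 0 ≤ p := norm_nonneg _
    set a := p * A p with ha
    have ha0 : 0 ≤ a := by
      rcases hp0.eq_or_lt with h | h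
      · rw [ha, ← h, zero_mul]
      · exact (mul_pos h (hA p h)).le
    have hdu : fderiv ℝ u x (V x) = a * p := by
      rw [← toDual_gradient, InnerProductSpace.toDual_apply_apply, hVu, inner_smul_right,
        real_inner_self_eq_norm_sq, ha, ← hp]
      ring
    have hVa : ‖V x‖ = a := by
      rcases hp0.eq_or_lt with h | h
      · rw [hVu, norm_smul, ← hp, ha, ← h]; simp
      · rw [hVu, norm_smul, ← hp, Real.norm_of_nonneg (hA p h).le, ha, mul_comm]
    have hdψ : -fderiv ℝ ψ x (V x) ≤ M / R * a := by
      refine (neg_le_abs _).trans ?_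
      rw [← Real.norm_eq_abs, ← hVa]
      exact (fderiv ℝ ψ x).le_of_opNorm_le (hψM x) _
    have hdφ : fderiv ℝ φ x (V x) = ψ x ^ s * (n * E x ^ n * (a * p)) +
        E x ^ n * (s * ψ x ^ ((N + 1) * n + N) * fderiv ℝ ψ x (V x)) := by
      have h1 := (hψ.differentiable one_ne_zero x).hasFDerivAt.pow s
      have h2 := (hu.differentiable one_ne_zero x).hasFDerivAt.exp.pow n
      have h3 : s - 1 = (N + 1) * n + N := by rw [hs]; ring_nf; omega
      have h4 : Real.exp (u x) ^ n = Real.exp (u x) ^ (n - 1) * Real.exp (u x) := by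
        rw [← pow_succ, Nat.sub_add_cancel hn]
      have h5 : fderiv ℝ φ x = _ := (h1.mul h2).fderiv
      rw [h5]
      simp only [E, h4, h3, add_apply, smul_apply, hdu, smul_eq_mul, nsmul_eq_mul]
      ring
    have hgrad := absorb_gradient (q := n) hC hK0 hR (hψ0 x) (hψ1 x) hp0 ha0 (hgrowth p hp0)
      (by exact_mod_cast hn)
    have hZ : 0 ≤ ψ x ^ (N + 1) * E x := mul_nonneg (pow_nonneg (hψ0 x) _) (hE0 x).le
    have hpow := absorb_power n hD₁0 hR0 (half_pos hc) hZ
    have hZn : 0 ≤ ψ x ^ ((N + 1) * n) * E x ^ n :=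
      mul_nonneg (pow_nonneg (hψ0 x) _) (pow_nonneg (hE0 x).le _)
    have hsψ : 0 ≤ E x ^ n * (s * ψ x ^ ((N + 1) * n + N)) :=
      mul_nonneg (pow_nonneg (hE0 x).le _) (mul_nonneg (by positivity) (pow_nonneg (hψ0 x) _))
    have hsplit : ψ x ^ s = ψ x ^ ((N + 1) * n) * ψ x ^ (N + 1) := by rw [hs, ← pow_add]; ring_nf
    calc -fderiv ℝ φ x (V x)
        = E x ^ n * (s * ψ x ^ ((N + 1) * n + N)) * (-fderiv ℝ ψ x (V x)) -
          ψ x ^ s * (n * E x ^ n * (a * p)) := by rw [hdφ]; ring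
      _ ≤ E x ^ n * (s * ψ x ^ ((N + 1) * n + N)) * (M / R * a) -
          ψ x ^ s * (n * E x ^ n * (a * p)) := by gcongr
      _ = ψ x ^ ((N + 1) * n) * E x ^ n *
          (ψ x ^ N * a * (K / R) - n * ψ x ^ (N + 1) * a * p) := by
        rw [hsplit, hK, pow_add]; ring
      _ ≤ ψ x ^ ((N + 1) * n) * E x ^ n * (D₁ / R) := by gcongr; linarith
      _ = D₁ / R * (ψ x ^ (N + 1) * E x) ^ n := by rw [mul_pow, ← pow_mul]; ring
      _ ≤ _ := hpow
      _ = c / 2 * (φ x * E x) + D₂ / R ^ (n + 1) := by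
        simp only [φ]
        rw [mul_pow, ← pow_mul, pow_succ (E x)]; ring
  have htr : Continuous fun x => (jacMatrix V x).trace := by
    simp only [Matrix.trace, Matrix.diag, jacMatrix]
    refine continuous_finsetSum _ fun i _ => ?_
    have hVi : ContDiff ℝ 1 fun y => V y i := by fun_prop
    exact (hVi.continuous_fderiv one_ne_zero).clm_apply continuous_const
  have hint₁ : Integrable fun x => φ x * (jacMatrix V x).trace :=
    (hφ.continuous.mul htr).integrable_of_hasCompactSupport hφc.mul_right
  have hint₂ : Integrable fun x => φ x * E x :=
    (hφ.continuous.mul hE.continuous).integrable_of_hasCompactSupport hφc.mul_right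
  have hint₃ : Integrable fun x => fderiv ℝ φ x (V x) := by
    refine ((hφ.continuous_fderiv one_ne_zero).clm_apply
      hV.continuous).integrable_of_hasCompactSupport ?_
    refine (hφc.fderiv ℝ).mono' ((Function.support_subset_iff'.2 fun x hx => ?_))
    rw [image_eq_zero_of_notMem_tsupport hx, zero_apply]
  have hball : ∀ x ∉ Metric.closedBall 0 (2 * R), fderiv ℝ φ x = 0 := by
    intro x hx
    have : φ =ᶠ[𝓝 x] fun _ => 0 := by
      filter_upwards [Metric.isClosed_closedBall.isOpen_compl.mem_nhds hx] with y hy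
      exact hφ2R y hy
    rw [this.fderiv_eq, fderiv_fun_const, Pi.zero_apply]
  have hvol : volume.real (Metric.closedBall (0 : Euc n) (2 * R)) = (2 * R) ^ n * ω := by
    rw [Measure.addHaar_real_closedBall' _ _ (by positivity), finrank_euclideanSpace_fin]
  have hupper : -∫ x, fderiv ℝ φ x (V x) ≤
      c / 2 * (∫ x, φ x * E x) + D₂ / R ^ (n + 1) * ((2 * R) ^ n * ω) := by
    have hfin : volume (Metric.closedBall (0 : Euc n) (2 * R)) ≠ ∞ :=
      measure_closedBall_lt_top.ne
    have hmeas : MeasurableSet (Metric.closedBall (0 : Euc n) (2 * R)) :=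
      Metric.isClosed_closedBall.measurableSet
    have hint₄ : Integrable
        ((Metric.closedBall (0 : Euc n) (2 * R)).indicator fun _ => D₂ / R ^ (n + 1)) :=
      (integrable_indicator_iff hmeas).2 (integrableOn_const hfin)
    rw [← integral_neg]
    calc ∫ x, -fderiv ℝ φ x (V x)
        ≤ ∫ x, (c / 2 * (φ x * E x) +
            (Metric.closedBall (0 : Euc n) (2 * R)).indicator (fun _ => D₂ / R ^ (n + 1)) x) := by
          refine integral_mono hint₃.neg ((hint₂.const_mul _).add hint₄) fun x => ?_
          by_cases hx : x ∈ Metric.closedBall (0 : Euc n) (2 * R)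
          · simpa only [indicator_of_mem hx] using hpt x
          · simp [indicator_of_notMem hx, hball x hx, hφ2R x hx]
      _ = _ := by
          rw [integral_add (hint₂.const_mul _) hint₄, integral_const_mul,
            integral_indicator_const _ hmeas, hvol, smul_eq_mul, mul_comm ((2 * R) ^ n * ω)]
  have hlower : c * ∫ x, φ x * E x ≤ -∫ x, fderiv ℝ φ x (V x) := by
    rw [← integral_mul_trace_jacMatrix hφ hφc hV, ← integral_const_mul]
    refine integral_mono (hint₂.const_mul c) hint₁ fun x => ?_
    have := mul_le_mul_of_nonneg_left (hdiv x) (hφ0 x)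
    simp only [E]
    linarith
  have hone : ∫ x in Metric.closedBall (0 : Euc n) 1, Real.exp (u x) ^ (n + 1) ≤
      ∫ x, φ x * E x := by
    rw [setIntegral_congr_fun (g := fun x => φ x * E x) Metric.isClosed_closedBall.measurableSet]
    · exact setIntegral_le_integral hint₂ (.of_forall fun x => mul_nonneg (hφ0 x) (hE0 x).le)
    · intro x hx
      simp [φ, E, hψR x (Metric.closedBall_subset_closedBall hR hx), pow_succ]
  have hsimp : D₂ / R ^ (n + 1) * ((2 * R) ^ n * ω) = D₂ * (2 ^ n * ω) / R := by
    rw [mul_pow, pow_succ]; field_simp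
  rw [hsimp] at hupper
  refine hone.trans ?_
  rw [div_right_comm, le_div_iff₀ (half_pos hc)]
  linarith

/-- Remark: under (103) and (108), the inequality with f(u) = e^u has no entire solution. -/
theorem no_solution_exp
    (n k : ℕ) (hk : 1 ≤ k) (hkn : k ≤ n) (A : ℝ → ℝ) (m : ℝ) (hm : 1 < m)
    (hA : Cond103 A) (h108 : Cond108 A m) :
    ¬ ∃ u : Euc n → ℝ, IsEntireSol n k A Real.exp u := by
  rintro ⟨u, hu, -, V, hV, hVu, hsym, hΓ, hsol⟩
  obtain ⟨C, hC, N, hgrowth⟩ := exists_growth_bound hA h108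
  have hb : 0 < (n.choose k : ℝ) ^ ((1 : ℝ) / k) :=
    Real.rpow_pos_of_pos (by exact_mod_cast Nat.choose_pos hkn) _
  have hdiv : ∀ x, ((n.choose k : ℝ) ^ ((1 : ℝ) / k))⁻¹ * Real.exp (u x) ≤
      (jacMatrix V x).trace := by
    intro x
    rw [inv_mul_le_iff₀ hb, (hsym x).trace_eq_sum_eigenvalues]
    exact (hsol x).trans (sigmaElem_rpow_le_of_mem_GammaK hk (hΓ x))
  obtain ⟨D, hD⟩ := exists_integral_exp_le (hk.trans hkn) hA.2.1 hC hgrowth (inv_pos.2 hb) hu hV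
    hVu hdiv
  have hle : ∫ x in Metric.closedBall (0 : Euc n) 1, Real.exp (u x) ^ (n + 1) ≤ 0 :=
    ge_of_tendsto (tendsto_const_nhds.div_atTop tendsto_id)
      ((eventually_ge_atTop 1).mono fun R hR => hD R hR)
  have hcont : Continuous fun x => Real.exp (u x) ^ (n + 1) := hu.continuous.rexp.pow _
  refine hle.not_gt ?_
  rw [setIntegral_pos_iff_support_of_nonneg_ae (.of_forall fun x => by positivity)
    (hcont.continuousOn.integrableOn_compact (isCompact_closedBall _ _))]
  have hsupp : Function.support (fun x => Real.exp (u x) ^ (n + 1)) = univ :=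
    Function.support_eq_univ fun x => by positivity
  rw [hsupp, univ_inter]
  exact Metric.measure_closedBall_pos _ _ one_pos
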